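/- arXiv:2601.17572 — 16 statements merged into one kernel-verified Lean document; each statement's English description precedes it below -/
import Mathlib

section
/- Assume the travel times satisfy the triangle inequality t_{u,v} + t_{v,w} ≥ t_{u,w} for all nodes u, v, w. Let 0 ≤ i and i+2 ≤ m ≤ n. If A(i,m−1) + s_{m−1} + t_{m−1,0} > T, then A(i,m) + s_m + t_{m,0} > T. Hence once a vehicle following the route can no longer finish service and return to the depot by time T, the same is true at every subsequent customer of the route. -/
theorem stmt_2 (n : ℕ) (hn : 1 ≤ n)
    (t : ℕ → ℕ → ℝ) (ht : ∀ u v, 0 ≤ t u v)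
    (htri : ∀ u v w, t u w ≤ t u v + t v w)
    (s a b : ℕ → ℝ) (hs : ∀ z, 0 ≤ s z) (T : ℝ)
    (A : ℕ → ℕ → ℝ)
    (hA1 : ∀ i, i + 1 ≤ n → A i (i + 1) = max (t 0 (i + 1)) (a (i + 1)))
    (hArec : ∀ i z, i + 2 ≤ z → z ≤ n →
      A i z = max (A i (z - 1) + s (z - 1) + t (z - 1) z) (a z)) :
    ∀ i m : ℕ, i + 2 ≤ m → m ≤ n →
      A i (m - 1) + s (m - 1) + t (m - 1) 0 > T →
        A i m + s m + t m 0 > T := by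
  intro i m him hmn hlate
  have hstart : A i (m - 1) + s (m - 1) + t (m - 1) m ≤ A i m :=
    (hArec i m him hmn).symm ▸ le_max_left _ _
  linarith [htri (m - 1) m 0, hs m]
end

section
/- Assume the travel times satisfy the triangle inequality t_{u,v} + t_{v,w} ≥ t_{u,w} for all nodes u, v, w. For all integers i, j with 0 ≤ i and i+2 ≤ j ≤ n, if feasible_a(i,j) holds then feasible_a(i+1,j) holds; that is, removing the first customer from a time-window feasible route leaves a time-window feasible route. -/
/-- The route serving customers `i+1, …, j` is time-window feasible:
`A(i,z) ≤ min(b_z, T − s_z − t_{z,0})` for every `z` with `i < z ≤ j`. -/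
def feasibleA (A : ℕ → ℕ → ℝ) (s b : ℕ → ℝ) (t : ℕ → ℕ → ℝ) (T : ℝ) (i j : ℕ) : Prop :=
  ∀ z, i < z → z ≤ j → A i z ≤ min (b z) (T - s z - t z 0)

theorem stmt_3 (n : ℕ) (hn : 1 ≤ n)
    (t : ℕ → ℕ → ℝ) (ht : ∀ u v, 0 ≤ t u v)
    (htri : ∀ u v w, t u w ≤ t u v + t v w)
    (s a b : ℕ → ℝ) (hs : ∀ z, 0 ≤ s z) (T : ℝ)
    (A : ℕ → ℕ → ℝ)
    (hA1 : ∀ i, i + 1 ≤ n → A i (i + 1) = max (t 0 (i + 1)) (a (i + 1)))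
    (hArec : ∀ i z, i + 2 ≤ z → z ≤ n →
      A i z = max (A i (z - 1) + s (z - 1) + t (z - 1) z) (a z)) :
    ∀ i j : ℕ, i + 2 ≤ j → j ≤ n →
      feasibleA A s b t T i j → feasibleA A s b t T (i + 1) j := by
  intro i j hij hjn hfeas
  have A_succ_le : ∀ z, i + 2 ≤ z → z ≤ n → A (i + 1) z ≤ A i z := by
    intro z hz
    induction z, hz using Nat.le_induction with
    | base =>
      intro hzn
      have h_first : t 0 (i + 1) ≤ A i (i + 1) := by
        rw [hA1 i (by omega)]
        exact le_max_left _ _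
      rw [hA1 (i + 1) hzn, hArec i (i + 2) le_rfl hzn]
      refine max_le_max ?_ le_rfl
      change t 0 (i + 2) ≤ A i (i + 1) + s (i + 1) + t (i + 1) (i + 2)
      linarith [htri 0 (i + 1) (i + 2), hs (i + 1)]
    | succ z hz ih =>
      intro hzn
      rw [hArec (i + 1) (z + 1) (by omega) hzn, hArec i (z + 1) (by omega) hzn,
        Nat.add_sub_cancel]
      have := ih (by omega)
      gcongr
  intro z hz hzj
  exact (A_succ_le z hz (hzj.trans hjn)).trans (hfeas z (by omega) hzj)
end

section
/- For all integers i, j with 0 ≤ i, i+1 < j ≤ n, if feasible_h(i,j) holds then feasible_h(i+1,j) holds; that is, removing the first customer from a capacity-feasible simultaneous-pickup-and-delivery route leaves a capacity-feasible route. -/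
/-- Vehicle load just after serving customer `j` on the route that leaves the
depot after tour position `i` and serves customers `i+1, …, k`:
`load(i,j,k) := (P[j] − P[i]) + (D[k] − D[j])`. -/
def load (P D : ℕ → ℝ) (i j k : ℕ) : ℝ :=
  (P j - P i) + (D k - D j)

theorem stmt_4 (n : ℕ) (hn : 1 ≤ n)
    (d p : ℕ → ℝ) (hd : ∀ z, 0 ≤ d z) (hp : ∀ z, 0 ≤ p z)
    (hd0 : d 0 = 0) (hp0 : p 0 = 0)
    (D P : ℕ → ℝ) (hD0 : D 0 = 0) (hP0 : P 0 = 0)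
    (hD : ∀ i, 1 ≤ i → i ≤ n → D i = D (i - 1) + d i)
    (hP : ∀ i, 1 ≤ i → i ≤ n → P i = P (i - 1) + p i)
    (hst : ℕ → ℕ → ℕ)
    (hst_lb : ∀ i k, i ≤ k → k ≤ n → i ≤ hst i k)
    (hst_ub : ∀ i k, i ≤ k → k ≤ n → hst i k ≤ k)
    (hst_max : ∀ i k, i ≤ k → k ≤ n → ∀ j, i ≤ j → j ≤ k →
      load P D i j k ≤ load P D i (hst i k) k)
    (hst_tie : ∀ i k, i ≤ k → k ≤ n → ∀ j, i ≤ j → j ≤ k →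
      load P D i j k = load P D i (hst i k) k → j ≤ hst i k)
    (Q : ℝ) (hQ : 0 ≤ Q) :
    ∀ i j : ℕ, i + 1 < j → j ≤ n →
      load P D i (hst i j) j ≤ Q →
        load P D (i + 1) (hst (i + 1) j) j ≤ Q := by
  intro i j hij hjn hQi
  have hlb := hst_lb (i + 1) j (by omega) hjn
  have hub := hst_ub (i + 1) j (by omega) hjn
  have hmax := hst_max i j (by omega) hjn (hst (i + 1) j) (by omega) hub
  have hPi := hP (i + 1) (by omega) (by omega)
  rw [Nat.add_sub_cancel] at hPi
  have hpi := hp (i + 1)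
  simp only [load] at *
  linarith
end

section
/- For all integers i, j with 0 ≤ i < j < n, if feasible_h(i,j) fails then feasible_h(i,j+1) fails; that is, appending an additional customer to the end of a capacity-infeasible simultaneous-pickup-and-delivery route cannot make the route capacity-feasible. -/
theorem stmt_5 (n : ℕ) (hn : 1 ≤ n)
    (d p : ℕ → ℝ) (hd : ∀ z, 0 ≤ d z) (hp : ∀ z, 0 ≤ p z)
    (hd0 : d 0 = 0) (hp0 : p 0 = 0)
    (D P : ℕ → ℝ) (hD0 : D 0 = 0) (hP0 : P 0 = 0)
    (hD : ∀ i, 1 ≤ i → i ≤ n → D i = D (i - 1) + d i)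
    (hP : ∀ i, 1 ≤ i → i ≤ n → P i = P (i - 1) + p i)
    (hst : ℕ → ℕ → ℕ)
    (hst_lb : ∀ i k, i ≤ k → k ≤ n → i ≤ hst i k)
    (hst_ub : ∀ i k, i ≤ k → k ≤ n → hst i k ≤ k)
    (hst_max : ∀ i k, i ≤ k → k ≤ n → ∀ j, i ≤ j → j ≤ k →
      load P D i j k ≤ load P D i (hst i k) k)
    (hst_tie : ∀ i k, i ≤ k → k ≤ n → ∀ j, i ≤ j → j ≤ k →
      load P D i j k = load P D i (hst i k) k → j ≤ hst i k)
    (Q : ℝ) (hQ : 0 ≤ Q) :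
    ∀ i j : ℕ, i < j → j < n →
      ¬ load P D i (hst i j) j ≤ Q →
        ¬ load P D i (hst i (j + 1)) (j + 1) ≤ Q := by
  intro i j hij hjn hinf hfeas
  have hub := hst_ub i j hij.le hjn.le
  have hmax := hst_max i (j + 1) (by omega) hjn (hst i j)
    (hst_lb i j hij.le hjn.le) (by omega)
  have hstep := hD (j + 1) (by omega) hjn
  rw [Nat.add_sub_cancel] at hstep
  have hdj := hd (j + 1)
  simp only [load] at hinf hfeas hmax
  linarith
end

section
/- The capacity penalty is monotone under route extension in both directions: for all integers i, j with 0 ≤ i < j < n, pen_{αh}(i,j) ≤ pen_{αh}(i,j+1); and for all integers x, y with 0 < x < y ≤ n, pen_{αh}(x,y) ≤ pen_{αh}(x−1,y). -/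
/-- Capacity penalty of the route serving customers `i+1, …, k`:
`pen_{αh}(i,k) := α · max(load(i, highest(i,k), k) − Q, 0)`. -/
def penAH (α Q : ℝ) (P D : ℕ → ℝ) (hst : ℕ → ℕ → ℕ) (i k : ℕ) : ℝ :=
  α * max (load P D i (hst i k) k - Q) 0

theorem stmt_7 (n : ℕ) (hn : 1 ≤ n)
    (d p : ℕ → ℝ) (hd : ∀ z, 0 ≤ d z) (hp : ∀ z, 0 ≤ p z)
    (hd0 : d 0 = 0) (hp0 : p 0 = 0)
    (D P : ℕ → ℝ) (hD0 : D 0 = 0) (hP0 : P 0 = 0)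
    (hD : ∀ i, 1 ≤ i → i ≤ n → D i = D (i - 1) + d i)
    (hP : ∀ i, 1 ≤ i → i ≤ n → P i = P (i - 1) + p i)
    (hst : ℕ → ℕ → ℕ)
    (hst_lb : ∀ i k, i ≤ k → k ≤ n → i ≤ hst i k)
    (hst_ub : ∀ i k, i ≤ k → k ≤ n → hst i k ≤ k)
    (hst_max : ∀ i k, i ≤ k → k ≤ n → ∀ j, i ≤ j → j ≤ k →
      load P D i j k ≤ load P D i (hst i k) k)
    (hst_tie : ∀ i k, i ≤ k → k ≤ n → ∀ j, i ≤ j → j ≤ k →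
      load P D i j k = load P D i (hst i k) k → j ≤ hst i k)
    (Q α : ℝ) (hQ : 0 ≤ Q) (hα : 0 ≤ α) :
    (∀ i j : ℕ, i < j → j < n →
      penAH α Q P D hst i j ≤ penAH α Q P D hst i (j + 1)) ∧
    (∀ x y : ℕ, 0 < x → x < y → y ≤ n →
      penAH α Q P D hst x y ≤ penAH α Q P D hst (x - 1) y) := by
  have penalty_mono {a b : ℝ} (h : a ≤ b) : α * max (a - Q) 0 ≤ α * max (b - Q) 0 := by
    gcongr
  refine ⟨fun i j hij hjn => penalty_mono ?_, fun x y hx hxy hyn => penalty_mono ?_⟩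
  · have hlb := hst_lb i j hij.le hjn.le
    have hub := hst_ub i j hij.le hjn.le
    refine le_trans ?_ (hst_max i (j + 1) (by omega) hjn (hst i j) hlb (by omega))
    have hstep := hD (j + 1) (by omega) hjn
    have hnonneg := hd (j + 1)
    simp only [load, Nat.add_sub_cancel] at hstep ⊢
    linarith
  · have hlb := hst_lb x y hxy.le hyn
    have hub := hst_ub x y hxy.le hyn
    refine le_trans ?_ (hst_max (x - 1) y (by omega) hyn (hst x y) (by omega) hub)
    have hstep := hP x hx (by omega)
    have hnonneg := hp x
    simp only [load]
    linarith
end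

section
/- For all integers i, j, x with 0 ≤ i < j ≤ x < n: if highest(i,x) = highest(j,x), then highest(i,x+1) = highest(j,x+1). -/
theorem stmt_9 (n : ℕ) (hn : 1 ≤ n)
    (d p : ℕ → ℝ) (hd : ∀ z, 0 ≤ d z) (hp : ∀ z, 0 ≤ p z)
    (hd0 : d 0 = 0) (hp0 : p 0 = 0)
    (D P : ℕ → ℝ) (hD0 : D 0 = 0) (hP0 : P 0 = 0)
    (hD : ∀ i, 1 ≤ i → i ≤ n → D i = D (i - 1) + d i)
    (hP : ∀ i, 1 ≤ i → i ≤ n → P i = P (i - 1) + p i)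
    (hst : ℕ → ℕ → ℕ)
    (hst_lb : ∀ i k, i ≤ k → k ≤ n → i ≤ hst i k)
    (hst_ub : ∀ i k, i ≤ k → k ≤ n → hst i k ≤ k)
    (hst_max : ∀ i k, i ≤ k → k ≤ n → ∀ j, i ≤ j → j ≤ k →
      load P D i j k ≤ load P D i (hst i k) k)
    (hst_tie : ∀ i k, i ≤ k → k ≤ n → ∀ j, i ≤ j → j ≤ k →
      load P D i j k = load P D i (hst i k) k → j ≤ hst i k)
    :
    ∀ i j x : ℕ, i < j → j ≤ x → x < n →
      hst i x = hst j x → hst i (x + 1) = hst j (x + 1) := by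
  intro i j x hij hjx hxn h
  have hix : i ≤ x := by omega
  have hix' : i ≤ x + 1 := by omega
  have hjx' : j ≤ x + 1 := by omega
  have hm_lb := hst_lb j x hjx hxn.le
  have hm_ub := hst_ub j x hjx hxn.le
  have ha_lb := hst_lb i (x + 1) hix' hxn
  have ha_ub := hst_ub i (x + 1) hix' hxn
  have hb_lb := hst_lb j (x + 1) hjx' hxn
  have hb_ub := hst_ub j (x + 1) hjx' hxn
  have hja : j ≤ hst i (x + 1) := by
    by_contra! hlt
    have h₁ := hst_max i x hix hxn.le (hst i (x + 1)) ha_lb (by omega)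
    have h₂ := hst_max i (x + 1) hix' hxn (hst i x) (by omega) (by omega)
    have h₃ := hst_tie i (x + 1) hix' hxn (hst i x) (by omega) (by omega)
      (by unfold load at *; linarith)
    omega
  have h₁ := hst_max i (x + 1) hix' hxn (hst j (x + 1)) (by omega) hb_ub
  have h₂ := hst_max j (x + 1) hjx' hxn (hst i (x + 1)) hja ha_ub
  apply le_antisymm
  · exact hst_tie j (x + 1) hjx' hxn _ hja ha_ub (by unfold load at *; linarith)
  · exact hst_tie i (x + 1) hix' hxn _ (by omega) hb_ub (by unfold load at *; linarith)
end

section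
/- Let 0 ≤ i < j < x ≤ n and suppose pen_{αh}(i,x) > 0, pen_{αh}(j,x) > 0, and highest(i,x) = highest(j,x). Then for every y with x ≤ y ≤ n: pen_{αh}(i,y) − pen_{αh}(j,y) = α · (P[j] − P[i]); in particular the penalty difference is a constant that does not depend on y. -/
theorem monotone_prefix_sum {n : ℕ} {d D : ℕ → ℝ} (hd : ∀ z, 0 ≤ d z)
    (hD : ∀ i, 1 ≤ i → i ≤ n → D i = D (i - 1) + d i) {x y : ℕ} (hxy : x ≤ y) (hy : y ≤ n) :
    D x ≤ D y := by
  induction y, hxy using Nat.le_induction with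
  | base => exact le_rfl
  | succ m _ ih =>
    have hm := hD (m + 1) (by omega) hy
    rw [Nat.add_sub_cancel] at hm
    linarith [ih (by omega), hd (m + 1)]

theorem load_highest_of_penAH_pos {α Q : ℝ} {P D : ℕ → ℝ} {hst : ℕ → ℕ → ℕ} {i k : ℕ}
    (h : 0 < penAH α Q P D hst i k) : Q < load P D i (hst i k) k := by
  by_contra! hle
  simp [penAH, max_eq_right (sub_nonpos.2 hle)] at h

theorem stmt_10 (n : ℕ) (hn : 1 ≤ n)
    (d p : ℕ → ℝ) (hd : ∀ z, 0 ≤ d z) (hp : ∀ z, 0 ≤ p z)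
    (hd0 : d 0 = 0) (hp0 : p 0 = 0)
    (D P : ℕ → ℝ) (hD0 : D 0 = 0) (hP0 : P 0 = 0)
    (hD : ∀ i, 1 ≤ i → i ≤ n → D i = D (i - 1) + d i)
    (hP : ∀ i, 1 ≤ i → i ≤ n → P i = P (i - 1) + p i)
    (hst : ℕ → ℕ → ℕ)
    (hst_lb : ∀ i k, i ≤ k → k ≤ n → i ≤ hst i k)
    (hst_ub : ∀ i k, i ≤ k → k ≤ n → hst i k ≤ k)
    (hst_max : ∀ i k, i ≤ k → k ≤ n → ∀ j, i ≤ j → j ≤ k →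
      load P D i j k ≤ load P D i (hst i k) k)
    (hst_tie : ∀ i k, i ≤ k → k ≤ n → ∀ j, i ≤ j → j ≤ k →
      load P D i j k = load P D i (hst i k) k → j ≤ hst i k)
    (Q α : ℝ) (hQ : 0 ≤ Q) (hα : 0 ≤ α) :
    ∀ i j x : ℕ, i < j → j < x → x ≤ n →
      0 < penAH α Q P D hst i x → 0 < penAH α Q P D hst j x →
      hst i x = hst j x →
        ∀ y : ℕ, x ≤ y → y ≤ n →
          penAH α Q P D hst i y - penAH α Q P D hst j y = α * (P j - P i) := by
  intro i j x hij hjx hxn hpi hpj hh y hxy hyn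
  have hDxy := monotone_prefix_sum hd hD hxy hyn
  have hli := load_highest_of_penAH_pos hpi
  have hlj := load_highest_of_penAH_pos hpj
  have hjh := hst_lb j x (by omega) hxn
  have hhx := hst_ub j x (by omega) hxn
  have hjb := hst_lb j y (by omega) hyn
  have hby := hst_ub j y (by omega) hyn
  have hia := hst_lb i y (by omega) hyn
  have hay := hst_ub i y (by omega) hyn
  have hba := hst_max i y (by omega) hyn (hst j y) (by omega) hby
  have hha := hst_max i y (by omega) hyn (hst j x) (by omega) (by omega)
  have hhb := hst_max j y (by omega) hyn (hst j x) hjh (by omega)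
  have hab : load P D j (hst i y) y ≤ load P D j (hst j y) y := by
    rcases le_or_gt j (hst i y) with hja | haj
    · exact hst_max j y (by omega) hyn _ hja hay
    · have hah := hst_max i x (by omega) hxn (hst i y) hia (by omega)
      rw [hh] at hah
      simp only [load] at *
      linarith
  rw [hh] at hli
  unfold penAH
  simp only [load] at *
  rw [max_eq_left (by linarith), max_eq_left (by linarith), ← mul_sub]
  congr 1
  linarith
end

section
/- For all integers i, j, x with 0 ≤ i < j ≤ x < n: if highest(j,x) = highest(j,x+1), then highest(i,x) = highest(i,x+1). -/
theorem stmt_11 (n : ℕ) (hn : 1 ≤ n)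
    (d p : ℕ → ℝ) (hd : ∀ z, 0 ≤ d z) (hp : ∀ z, 0 ≤ p z)
    (hd0 : d 0 = 0) (hp0 : p 0 = 0)
    (D P : ℕ → ℝ) (hD0 : D 0 = 0) (hP0 : P 0 = 0)
    (hD : ∀ i, 1 ≤ i → i ≤ n → D i = D (i - 1) + d i)
    (hP : ∀ i, 1 ≤ i → i ≤ n → P i = P (i - 1) + p i)
    (hst : ℕ → ℕ → ℕ)
    (hst_lb : ∀ i k, i ≤ k → k ≤ n → i ≤ hst i k)
    (hst_ub : ∀ i k, i ≤ k → k ≤ n → hst i k ≤ k)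
    (hst_max : ∀ i k, i ≤ k → k ≤ n → ∀ j, i ≤ j → j ≤ k →
      load P D i j k ≤ load P D i (hst i k) k)
    (hst_tie : ∀ i k, i ≤ k → k ≤ n → ∀ j, i ≤ j → j ≤ k →
      load P D i j k = load P D i (hst i k) k → j ≤ hst i k)
    :
    ∀ i j x : ℕ, i < j → j ≤ x → x < n →
      hst j x = hst j (x + 1) → hst i x = hst i (x + 1) := by
  intro i j x hij hjx hxn h
  have hc_lb := hst_lb j x hjx (by omega)
  have hc_ub := hst_ub j x hjx (by omega)
  have ha_lb := hst_lb i x (by omega) (by omega)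
  have ha_ub := hst_ub i x (by omega) (by omega)
  have hb_lb := hst_lb i (x + 1) (by omega) (by omega)
  have hb_ub := hst_ub i (x + 1) (by omega) (by omega)
  have hlast := hst_max j (x + 1) (by omega) (by omega) (x + 1) (by omega) le_rfl
  have hlast_tie := hst_tie j (x + 1) (by omega) (by omega) (x + 1) (by omega) le_rfl
  have hcb := hst_max i (x + 1) (by omega) (by omega) (hst j x) (by omega) (by omega)
  rw [← h] at hlast hlast_tie
  -- The new position `x + 1` is strictly worse than the old maximizer on `{j, …, x}`.
  have hb : hst i (x + 1) ≤ x := by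
    by_contra hne
    have hbx : hst i (x + 1) = x + 1 := by omega
    rw [hbx] at hcb
    have : x + 1 ≤ hst j x := hlast_tie (by simp only [load] at *; linarith)
    omega
  have hba := hst_max i x (by omega) (by omega) (hst i (x + 1)) hb_lb hb
  have hab := hst_max i (x + 1) (by omega) (by omega) (hst i x) ha_lb (by omega)
  apply le_antisymm
  · exact hst_tie i (x + 1) (by omega) (by omega) _ ha_lb (by omega)
      (by simp only [load] at *; linarith)
  · exact hst_tie i x (by omega) (by omega) _ hb_lb hb
      (by simp only [load] at *; linarith)
end

section
/- Let 0 ≤ i < j < x < n and suppose pen_{αh}(i,x) > 0 and pen_{αh}(j,x) > 0. If highest(j,x) = highest(j,x+1), then pen_{αh}(i,x+1) − pen_{αh}(i,x) = pen_{αh}(j,x+1) − pen_{αh}(j,x); that is, both penalized routes incur the same penalty increase when customer x+1 is appended. -/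
/-- If appending a customer keeps the peak value of `P - D`, a positive penalty grows by `α` times
the increment of `D`. -/
theorem penAH_succ_sub {α Q : ℝ} {P D : ℕ → ℝ} {hst : ℕ → ℕ → ℕ} {i x : ℕ}
    (hD : D x ≤ D (x + 1)) (hpos : 0 < penAH α Q P D hst i x)
    (heq : P (hst i (x + 1)) - D (hst i (x + 1)) = P (hst i x) - D (hst i x)) :
    penAH α Q P D hst i (x + 1) - penAH α Q P D hst i x = α * (D (x + 1) - D x) := by
  have hload : 0 < load P D i (hst i x) x - Q := by
    by_contra! h
    simp [penAH, max_eq_right h] at hpos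
  have hnext : load P D i (hst i (x + 1)) (x + 1) - Q
      = load P D i (hst i x) x - Q + (D (x + 1) - D x) := by
    simp only [load]
    linarith
  simp only [penAH]
  rw [hnext, max_eq_left hload.le, max_eq_left (by linarith)]
  ring


theorem stmt_12 (n : ℕ) (hn : 1 ≤ n)
    (d p : ℕ → ℝ) (hd : ∀ z, 0 ≤ d z) (hp : ∀ z, 0 ≤ p z)
    (hd0 : d 0 = 0) (hp0 : p 0 = 0)
    (D P : ℕ → ℝ) (hD0 : D 0 = 0) (hP0 : P 0 = 0)
    (hD : ∀ i, 1 ≤ i → i ≤ n → D i = D (i - 1) + d i)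
    (hP : ∀ i, 1 ≤ i → i ≤ n → P i = P (i - 1) + p i)
    (hst : ℕ → ℕ → ℕ)
    (hst_lb : ∀ i k, i ≤ k → k ≤ n → i ≤ hst i k)
    (hst_ub : ∀ i k, i ≤ k → k ≤ n → hst i k ≤ k)
    (hst_max : ∀ i k, i ≤ k → k ≤ n → ∀ j, i ≤ j → j ≤ k →
      load P D i j k ≤ load P D i (hst i k) k)
    (hst_tie : ∀ i k, i ≤ k → k ≤ n → ∀ j, i ≤ j → j ≤ k →
      load P D i j k = load P D i (hst i k) k → j ≤ hst i k)
    (Q α : ℝ) (hQ : 0 ≤ Q) (hα : 0 ≤ α) :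
    ∀ i j x : ℕ, i < j → j < x → x < n →
      0 < penAH α Q P D hst i x → 0 < penAH α Q P D hst j x →
      hst j x = hst j (x + 1) →
        penAH α Q P D hst i (x + 1) - penAH α Q P D hst i x
          = penAH α Q P D hst j (x + 1) - penAH α Q P D hst j x := by
  intro i j x hij hjx hxn hpi hpj hh
  have hDx : D x ≤ D (x + 1) := by
    have h := hD (x + 1) (by omega) (by omega)
    rw [Nat.add_sub_cancel] at h
    linarith [hd (x + 1)]
  have hmax : ∀ a k, a ≤ k → k ≤ n → ∀ b, a ≤ b → b ≤ k →
      P b - D b ≤ P (hst a k) - D (hst a k) := by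
    intro a k hak hk b hab hbk
    have h := hst_max a k hak hk b hab hbk
    simp only [load] at h
    linarith
  have heq : P (hst i (x + 1)) - D (hst i (x + 1)) = P (hst i x) - D (hst i x) := by
    have hlb := hst_lb i (x + 1) (by omega) (by omega)
    have hub := hst_ub i (x + 1) (by omega) (by omega)
    have hlb' := hst_lb i x (by omega) (by omega)
    have hub' := hst_ub i x (by omega) (by omega)
    refine le_antisymm ?_ (hmax i (x + 1) (by omega) (by omega) _ hlb' (by omega))
    rcases hub.lt_or_eq with hlt | hlast
    · exact hmax i x (by omega) (by omega) _ hlb (by omega)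
    · have hjlb := hst_lb j x (by omega) (by omega)
      have hjub := hst_ub j x (by omega) (by omega)
      have hpeak := hmax j (x + 1) (by omega) (by omega) (x + 1) (by omega) le_rfl
      rw [← hh] at hpeak
      rw [hlast]
      exact hpeak.trans (hmax i x (by omega) (by omega) _ (by omega) hjub)
  rw [penAH_succ_sub hDx hpi heq, penAH_succ_sub hDx hpj (by rw [hh])]
end

section
/- Let 0 ≤ i < j < x < n and suppose pen_{αh}(i,x) > 0 and pen_{αh}(j,x) > 0. If highest(j,x) ≠ highest(j,x+1), then pen_{αh}(i,x+1) − pen_{αh}(i,x) ≤ pen_{αh}(j,x+1) − pen_{αh}(j,x); that is, the penalty of the later-starting penalized route grows at least as fast as that of the earlier-starting one when customer x+1 is appended. -/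
theorem stmt_13 (n : ℕ) (hn : 1 ≤ n)
    (d p : ℕ → ℝ) (hd : ∀ z, 0 ≤ d z) (hp : ∀ z, 0 ≤ p z)
    (hd0 : d 0 = 0) (hp0 : p 0 = 0)
    (D P : ℕ → ℝ) (hD0 : D 0 = 0) (hP0 : P 0 = 0)
    (hD : ∀ i, 1 ≤ i → i ≤ n → D i = D (i - 1) + d i)
    (hP : ∀ i, 1 ≤ i → i ≤ n → P i = P (i - 1) + p i)
    (hst : ℕ → ℕ → ℕ)
    (hst_lb : ∀ i k, i ≤ k → k ≤ n → i ≤ hst i k)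
    (hst_ub : ∀ i k, i ≤ k → k ≤ n → hst i k ≤ k)
    (hst_max : ∀ i k, i ≤ k → k ≤ n → ∀ j, i ≤ j → j ≤ k →
      load P D i j k ≤ load P D i (hst i k) k)
    (hst_tie : ∀ i k, i ≤ k → k ≤ n → ∀ j, i ≤ j → j ≤ k →
      load P D i j k = load P D i (hst i k) k → j ≤ hst i k)
    (Q α : ℝ) (hQ : 0 ≤ Q) (hα : 0 ≤ α) :
    ∀ i j x : ℕ, i < j → j < x → x < n →
      0 < penAH α Q P D hst i x → 0 < penAH α Q P D hst j x →
      hst j x ≠ hst j (x + 1) →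
        penAH α Q P D hst i (x + 1) - penAH α Q P D hst i x
          ≤ penAH α Q P D hst j (x + 1) - penAH α Q P D hst j x := by
  intro i j x hij hjx hxn hi hj _
  have hDx : D x ≤ D (x + 1) := by
    have h := hD (x + 1) (by omega) hxn
    have hd' := hd (x + 1)
    rw [Nat.add_sub_cancel] at h
    linarith
  have load_gt : ∀ s, 0 < penAH α Q P D hst s x → Q < load P D s (hst s x) x := by
    intro s hs
    by_contra! h
    simp [penAH, max_eq_right (sub_nonpos.2 h)] at hs
  have hQi := load_gt i hi
  have hQj := load_gt j hj
  have hci := hst_max i x (by omega) hxn.le (hst j x)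
    (hij.le.trans (hst_lb j x hjx.le hxn.le)) (hst_ub j x hjx.le hxn.le)
  have hai := hst_max i (x + 1) (by omega) hxn (hst i x)
    (hst_lb i x (by omega) hxn.le) ((hst_ub i x (by omega) hxn.le).trans x.le_succ)
  have hcj := hst_max j (x + 1) (by omega) hxn (hst j x)
    (hst_lb j x hjx.le hxn.le) ((hst_ub j x hjx.le hxn.le).trans x.le_succ)
  have hxj := hst_max j (x + 1) (by omega) hxn (x + 1) (by omega) le_rfl
  have hbi : hst i (x + 1) = x + 1 ∨
      load P D i (hst i (x + 1)) x ≤ load P D i (hst i x) x := by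
    have hlb := hst_lb i (x + 1) (by omega) hxn
    have hub := hst_ub i (x + 1) (by omega) hxn
    rcases hub.eq_or_lt with h | h
    · exact Or.inl h
    · exact Or.inr (hst_max i x (by omega) hxn.le _ hlb (Nat.le_of_lt_succ h))
  simp only [penAH, ← mul_sub]
  refine mul_le_mul_of_nonneg_left ?_ hα
  simp only [load] at *
  rw [max_eq_left (by linarith), max_eq_left (by linarith), max_eq_left (by linarith),
    max_eq_left (by linarith)]
  rcases hbi with h | h
  · rw [h]
    linarith
  · linarith
end

section
/- For all integers i, j with 0 ≤ i < j ≤ n: A(i,j) = max( t_{0,i+1} + S[j] − S[i+1], a_{wait(i,j)} + S[j] − S[wait(i,j)] ). That is, the recursively defined service start time at customer j equals the maximum of the no-waiting arrival time and the departure time propagated from the last customer at which waiting can occur. -/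
theorem stmt_14 (n : ℕ) (hn : 1 ≤ n)
    (t : ℕ → ℕ → ℝ) (ht : ∀ u v, 0 ≤ t u v)
    (s a b : ℕ → ℝ) (hs : ∀ z, 0 ≤ s z) (hs0 : s 0 = 0) (T : ℝ)
    (A : ℕ → ℕ → ℝ)
    (hA1 : ∀ i, i + 1 ≤ n → A i (i + 1) = max (t 0 (i + 1)) (a (i + 1)))
    (hArec : ∀ i z, i + 2 ≤ z → z ≤ n →
      A i z = max (A i (z - 1) + s (z - 1) + t (z - 1) z) (a z))
    (S : ℕ → ℝ) (hS0 : S 0 = 0)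
    (hS : ∀ i, 1 ≤ i → i ≤ n → S i = S (i - 1) + s (i - 1) + t (i - 1) i)
    -- `a_y + S[z] − S[y] > a_z` for every `z ∈ {y+1,…,j}`.
    (w : ℕ → ℕ → ℕ)
    (hw_lb : ∀ i j, i < j → j ≤ n → i + 1 ≤ w i j)
    (hw_ub : ∀ i j, i < j → j ≤ n → w i j ≤ j)
    (hw_prop : ∀ i j, i < j → j ≤ n →
      ∀ z, w i j < z → z ≤ j → a (w i j) + S z - S (w i j) > a z)
    (hw_least : ∀ i j, i < j → j ≤ n →
      ∀ y, i + 1 ≤ y → y ≤ j → (∀ z, y < z → z ≤ j → a y + S z - S y > a z) →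
        w i j ≤ y) :
    ∀ i j : ℕ, i < j → j ≤ n →
      A i j = max (t 0 (i + 1) + S j - S (i + 1)) (a (w i j) + S j - S (w i j)) := by
  intro i j hij
  induction j, hij using Nat.le_induction with
  | base =>
    intro hj
    have hw : w i (i + 1) = i + 1 :=
      le_antisymm (hw_ub i _ (Nat.lt_succ_self i) hj) (hw_lb i _ (Nat.lt_succ_self i) hj)
    simp [hw, hA1 i hj]
  | succ j hij ih =>
    intro hj
    have hij' : i < j := hij
    have hjn : j ≤ n := by omega
    have hS' : S (j + 1) = S j + s j + t j (j + 1) := hS (j + 1) (by omega) hj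
    have hA : A i (j + 1) = max (A i j + s j + t j (j + 1)) (a (j + 1)) :=
      hArec i (j + 1) (by omega) hj
    have hlb := hw_lb i j hij' hjn
    have hub := hw_ub i j hij' hjn
    have hprop := hw_prop i j hij' hjn
    have hlb' := hw_lb i (j + 1) (by omega) hj
    have hub' := hw_ub i (j + 1) (by omega) hj
    have hprop' := hw_prop i (j + 1) (by omega) hj
    have hle : w i (j + 1) ≤ j → w i j ≤ w i (j + 1) := fun h =>
      hw_least i j hij' hjn _ hlb' h fun z hz hzj => hprop' z hz (by omega)
    rw [hA, ih hjn]
    by_cases hlast : a (w i j) + S (j + 1) - S (w i j) > a (j + 1)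
    · have hle' : w i (j + 1) ≤ w i j := by
        refine hw_least i (j + 1) (by omega) hj _ hlb (by omega) fun z hz hzj => ?_
        rcases Nat.le_succ_iff.mp hzj with h | rfl
        · exact hprop z hz h
        · exact hlast
      have hw : w i (j + 1) = w i j := le_antisymm hle' (hle (by omega))
      rw [hw, max_eq_left, add_assoc, max_add]
      · congr 1 <;> linarith
      · linarith [le_max_right (t 0 (i + 1) + S j - S (i + 1)) (a (w i j) + S j - S (w i j))]
    · have hw : w i (j + 1) = j + 1 := by
        by_contra hne
        have hlt : w i (j + 1) ≤ j := by omega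
        have hnew := hprop' (j + 1) (by omega) le_rfl
        rcases (hle hlt).eq_or_lt with h | h
        · rw [← h] at hnew
          exact hlast hnew
        · linarith [hprop _ h hlt]
      have hshift : ∀ x y : ℝ, max x y + s j + t j (j + 1) =
          max (x + s j + t j (j + 1)) (y + s j + t j (j + 1)) := fun x y => by
        rw [max_add, max_add]
      rw [hw, hshift, max_assoc, max_eq_right (a := a (w i j) + S j - S (w i j) + _ + _)]
      · congr 1 <;> linarith
      · linarith
end

section
/- Assume the travel times satisfy the triangle inequality t_{u,v} + t_{v,w} ≥ t_{u,w} for all nodes u, v, w, and assume singleton-feasibility. Let 0 ≤ i < j ≤ n and suppose firstWarp(i) exists and firstWarp(i) ≤ j. Then Σ_{z=i+1}^{j} B(i,z) = B(i, firstWarp(i)) + W[j] − W[firstWarp(i)]; equivalently, pen_{βa}(i,j) = β · ( B(i, firstWarp(i)) + W[j] − W[firstWarp(i)] ). -/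
/-- Time-warp penalty of the route serving customers `i+1, …, j`:
`pen_{βa}(i,j) := β · Σ_{z=i+1}^{j} B(i,z)`. -/
def penBA (β : ℝ) (B : ℕ → ℕ → ℝ) (i j : ℕ) : ℝ :=
  β * ∑ z ∈ Finset.Icc (i + 1) j, B i z

/-- `W[j] := Σ_{z=1}^{j} B(0,z)`. -/
def Wsum (B : ℕ → ℕ → ℝ) (j : ℕ) : ℝ :=
  ∑ z ∈ Finset.Icc 1 j, B 0 z

/-- `x` is `firstWarp(i)`: the least index `x` with `i < x ≤ n` and `B(i,x) > 0`. -/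
def IsFirstWarp (n : ℕ) (B : ℕ → ℕ → ℝ) (i x : ℕ) : Prop :=
  i < x ∧ x ≤ n ∧ 0 < B i x ∧ ∀ z, i < z → z < x → ¬ 0 < B i z

theorem stmt_15 (n : ℕ) (hn : 1 ≤ n)
    (t : ℕ → ℕ → ℝ) (ht : ∀ u v, 0 ≤ t u v)
    (htri : ∀ u v w, t u w ≤ t u v + t v w)
    (s a b : ℕ → ℝ) (hs : ∀ z, 0 ≤ s z) (T : ℝ) (β : ℝ) (hβ : 0 ≤ β)
    (Abar B : ℕ → ℕ → ℝ)
    (hA1 : ∀ i, i + 1 ≤ n → Abar i (i + 1) = max (t 0 (i + 1)) (a (i + 1)))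
    (hB1 : ∀ i, i + 1 ≤ n → B i (i + 1) = 0)
    (hArec : ∀ i z, i + 2 ≤ z → z ≤ n →
      Abar i z = max (Abar i (z - 1) - B i (z - 1) + s (z - 1) + t (z - 1) z) (a z))
    (hBrec : ∀ i z, i + 2 ≤ z → z ≤ n →
      B i z = max 0 (Abar i z - min (b z) (T - s z - t z 0)))
    (hsingleton : ∀ z, 1 ≤ z → z ≤ n →
      max (t 0 z) (a z) ≤ min (b z) (T - s z - t z 0))
    :
    ∀ i j x : ℕ, i < j → j ≤ n → IsFirstWarp n B i x → x ≤ j →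
      (∑ z ∈ Finset.Icc (i + 1) j, B i z = B i x + Wsum B j - Wsum B x) ∧
      penBA β B i j = β * (B i x + Wsum B j - Wsum B x) := by
  set C : ℕ → ℝ := fun z => min (b z) (T - s z - t z 0)
  have hB : ∀ i z, i < z → z ≤ n → B i z = max 0 (Abar i z - C z) := by
    intro i z hiz hzn
    rcases Nat.lt_or_ge (i + 1) z with h | h
    · exact hBrec i z h hzn
    · obtain rfl : z = i + 1 := by omega
      rw [hB1 i hzn, hA1 i hzn, max_eq_left]
      exact sub_nonpos.2 (hsingleton (i + 1) (by omega) hzn)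
  have hE : ∀ i z, i < z → z ≤ n → Abar i z - B i z = min (Abar i z) (C z) := by
    intro i z hiz hzn
    rw [hB i z hiz hzn]
    rcases le_total (Abar i z) (C z) with h | h
    · rw [max_eq_left (by linarith), min_eq_left h, sub_zero]
    · rw [max_eq_right (by linarith), min_eq_right h]
      ring
  have hstep : ∀ i z, i < z → z + 1 ≤ n →
      Abar i (z + 1) = max (min (Abar i z) (C z) + s z + t z (z + 1)) (a (z + 1)) := by
    intro i z hiz hzn
    rw [hArec i (z + 1) (by omega) hzn, Nat.add_sub_cancel, hE i z hiz (by omega)]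
  -- By the triangle inequality no route serves a customer earlier than a direct trip would.
  have hlow : ∀ i z, i + 1 ≤ z → z ≤ n → max (t 0 z) (a z) ≤ Abar i z := by
    intro i z hiz
    induction z, hiz using Nat.le_induction with
    | base => exact fun h => (hA1 i h).ge
    | succ z hz ih =>
      intro hzn
      have h1 := le_min (ih (by omega)) (hsingleton z (by omega) (by omega))
      have h2 : t 0 z ≤ min (Abar i z) (C z) := (le_max_left _ _).trans h1
      rw [hstep i z hz hzn]
      exact max_le_max_right _ (by linarith [htri 0 z (z + 1), hs z])
  have hmono : ∀ i z, i + 1 ≤ z → z ≤ n → Abar i z ≤ Abar 0 z := by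
    intro i z hiz
    induction z, hiz using Nat.le_induction with
    | base => exact fun h => (hA1 i h).trans_le (hlow 0 (i + 1) (by omega) h)
    | succ z hz ih =>
      intro hzn
      rw [hstep i z hz hzn, hstep 0 z (by omega) hzn]
      gcongr
      exact ih (by omega)
  intro i j x _ hjn ⟨hix, hxn, hpos, hmin⟩ hxj
  have hwarp : C x < Abar i x := by
    rw [hB i x hix hxn, lt_max_iff] at hpos
    rcases hpos with h | h <;> linarith
  have hmerge : ∀ z, x ≤ z → z ≤ n → min (Abar i z) (C z) = min (Abar 0 z) (C z) := by
    intro z hxz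
    induction z, hxz using Nat.le_induction with
    | base =>
      intro _
      rw [min_eq_right hwarp.le, min_eq_right (hwarp.le.trans (hmono i x hix hxn))]
    | succ z hz ih =>
      intro hzn
      rw [hstep i z (by omega) hzn, hstep 0 z (by omega) hzn, ih (by omega)]
  have hBeq : ∀ z, x + 1 ≤ z → z ≤ n → B i z = B 0 z := by
    intro z hxz hzn
    obtain ⟨y, rfl⟩ : ∃ y, z = y + 1 := ⟨z - 1, by omega⟩
    rw [hB i _ (by omega) hzn, hB 0 _ (by omega) hzn, hstep i y (by omega) hzn,
      hstep 0 y (by omega) hzn, hmerge y (by omega) (by omega)]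
  have hsum : ∑ z ∈ Finset.Icc (i + 1) j, B i z = B i x + Wsum B j - Wsum B x := by
    induction j, hxj using Nat.le_induction with
    | base =>
      rw [add_sub_cancel_right]
      refine Finset.sum_eq_single_of_mem x (Finset.mem_Icc.2 ⟨hix, le_rfl⟩) ?_
      intro z hz hzx
      rw [Finset.mem_Icc] at hz
      refine le_antisymm (not_lt.1 (hmin z hz.1 (by omega))) ?_
      rw [hB i z hz.1 (by omega)]
      exact le_max_left _ _
    | succ j hj ih =>
      rw [Finset.sum_Icc_succ_top (by omega), ih (by omega) (by omega),
        hBeq (j + 1) (by omega) hjn]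
      simp only [Wsum]
      rw [Finset.sum_Icc_succ_top (b := j) (by omega)]
      ring
  exact ⟨hsum, by rw [penBA, hsum]⟩
end

section
/- Assume the travel times satisfy the triangle inequality t_{u,v} + t_{v,w} ≥ t_{u,w} for all nodes u, v, w, and assume singleton-feasibility. For every i with 0 ≤ i < n, if x := firstWarp(i) exists, then B(0,x) > 0; that is, the first customer at which a route starting after tour position i warps is also a customer at which the route starting at the depot position 0 warps. -/
theorem stmt_16 (n : ℕ) (hn : 1 ≤ n)
    (t : ℕ → ℕ → ℝ) (ht : ∀ u v, 0 ≤ t u v)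
    (htri : ∀ u v w, t u w ≤ t u v + t v w)
    (s a b : ℕ → ℝ) (hs : ∀ z, 0 ≤ s z) (T : ℝ) (β : ℝ) (hβ : 0 ≤ β)
    (Abar B : ℕ → ℕ → ℝ)
    (hA1 : ∀ i, i + 1 ≤ n → Abar i (i + 1) = max (t 0 (i + 1)) (a (i + 1)))
    (hB1 : ∀ i, i + 1 ≤ n → B i (i + 1) = 0)
    (hArec : ∀ i z, i + 2 ≤ z → z ≤ n →
      Abar i z = max (Abar i (z - 1) - B i (z - 1) + s (z - 1) + t (z - 1) z) (a z))
    (hBrec : ∀ i z, i + 2 ≤ z → z ≤ n →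
      B i z = max 0 (Abar i z - min (b z) (T - s z - t z 0)))
    (hsingleton : ∀ z, 1 ≤ z → z ≤ n →
      max (t 0 z) (a z) ≤ min (b z) (T - s z - t z 0))
    :
    ∀ i x : ℕ, i < n → IsFirstWarp n B i x → 0 < B 0 x := by
  have hB : ∀ i z, i + 1 ≤ z → z ≤ n →
      B i z = max 0 (Abar i z - min (b z) (T - s z - t z 0)) := by
    intro i z hiz hzn
    obtain rfl | hlt := hiz.eq_or_lt
    · rw [hB1 i hzn, hA1 i hzn,
        max_eq_left (sub_nonpos.mpr (hsingleton (i + 1) (by omega) hzn))]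
    · exact hBrec i z hlt hzn
  have hdep : ∀ i z, i + 1 ≤ z → z ≤ n →
      Abar i z - B i z = min (Abar i z) (min (b z) (T - s z - t z 0)) := by
    intro i z hiz hzn
    rw [hB i z hiz hzn]
    grind
  -- The start from position 0 is never earlier than that of a route beginning at `z`.
  have hlow : ∀ z, 1 ≤ z → z ≤ n → max (t 0 z) (a z) ≤ Abar 0 z := by
    intro z hz
    induction z, hz using Nat.le_induction with
    | base => exact fun h => (hA1 0 h).ge
    | succ z hz ih =>
      intro hzn
      have hprev : max (t 0 z) (a z) ≤ Abar 0 z - B 0 z := by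
        rw [hdep 0 z (by omega) (by omega)]
        exact le_min (ih (by omega)) (hsingleton z hz (by omega))
      rw [hArec 0 (z + 1) (by omega) hzn, Nat.add_sub_cancel]
      refine max_le_max_right _ ?_
      linarith [htri 0 z (z + 1), hs z, le_max_left (t 0 z) (a z)]
  have hmono : ∀ i z, i + 1 ≤ z → z ≤ n → Abar i z ≤ Abar 0 z := by
    intro i z hiz
    induction z, hiz using Nat.le_induction with
    | base => exact fun h => (hA1 i h).trans_le (hlow _ (by omega) h)
    | succ z hz ih =>
      intro hzn
      have hprev : Abar i z - B i z ≤ Abar 0 z - B 0 z := by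
        rw [hdep 0 z (by omega) (by omega), hdep i z hz (by omega)]
        exact min_le_min_right _ (ih (by omega))
      rw [hArec 0 (z + 1) (by omega) hzn, hArec i (z + 1) (by omega) hzn, Nat.add_sub_cancel]
      exact max_le_max_right _ (by linarith)
  rintro i x - ⟨hix, hxn, hpos, -⟩
  refine hpos.trans_le ?_
  rw [hB i x hix hxn, hB 0 x (by omega) hxn]
  exact max_le_max_left _ (sub_le_sub_right (hmono i x hix hxn) _)
end

section
/- Assume the travel times satisfy the triangle inequality t_{u,v} + t_{v,w} ≥ t_{u,w} for all nodes u, v, w, and assume singleton-feasibility. Then the time-warp penalty is monotone under route extension in both directions: for all 0 ≤ i < j < n, pen_{βa}(i,j) ≤ pen_{βa}(i,j+1); and for all 0 < x < y ≤ n, pen_{βa}(x,y) ≤ pen_{βa}(x−1,y). -/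
theorem stmt_17 (n : ℕ) (hn : 1 ≤ n)
    (t : ℕ → ℕ → ℝ) (ht : ∀ u v, 0 ≤ t u v)
    (htri : ∀ u v w, t u w ≤ t u v + t v w)
    (s a b : ℕ → ℝ) (hs : ∀ z, 0 ≤ s z) (T : ℝ) (β : ℝ) (hβ : 0 ≤ β)
    (Abar B : ℕ → ℕ → ℝ)
    (hA1 : ∀ i, i + 1 ≤ n → Abar i (i + 1) = max (t 0 (i + 1)) (a (i + 1)))
    (hB1 : ∀ i, i + 1 ≤ n → B i (i + 1) = 0)
    (hArec : ∀ i z, i + 2 ≤ z → z ≤ n →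
      Abar i z = max (Abar i (z - 1) - B i (z - 1) + s (z - 1) + t (z - 1) z) (a z))
    (hBrec : ∀ i z, i + 2 ≤ z → z ≤ n →
      B i z = max 0 (Abar i z - min (b z) (T - s z - t z 0)))
    (hsingleton : ∀ z, 1 ≤ z → z ≤ n →
      max (t 0 z) (a z) ≤ min (b z) (T - s z - t z 0))
    :
    (∀ i j : ℕ, i < j → j < n → penBA β B i j ≤ penBA β B i (j + 1)) ∧
    (∀ x y : ℕ, 0 < x → x < y → y ≤ n →
      penBA β B x y ≤ penBA β B (x - 1) y) := by
  constructor
  · intro i j hij hjn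
    unfold penBA
    rw [Finset.sum_Icc_succ_top (by omega)]
    have hB : 0 ≤ B i (j + 1) := by
      rw [hBrec i (j + 1) (by omega) (by omega)]
      exact le_max_left _ _
    exact mul_le_mul_of_nonneg_left (le_add_of_nonneg_right hB) hβ
  · intro x y hx hxy hyn
    obtain ⟨i, rfl⟩ : ∃ i, x = i + 1 := ⟨x - 1, by omega⟩
    rw [Nat.add_sub_cancel]
    have hmono : ∀ z, i + 2 ≤ z → z ≤ n →
        Abar (i + 1) z ≤ Abar i z ∧ B (i + 1) z ≤ B i z ∧
          Abar (i + 1) z - B (i + 1) z ≤ Abar i z - B i z := by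
      intro z hz
      induction z, hz using Nat.le_induction with
      | base =>
        intro hzn
        have hA : Abar (i + 1) (i + 2) ≤ Abar i (i + 2) := by
          rw [hA1 (i + 1) hzn, hArec i (i + 2) le_rfl hzn]
          simp only [show i + 2 - 1 = i + 1 by omega, show i + 1 + 1 = i + 2 by omega]
          rw [hB1 i (by omega), hA1 i (by omega)]
          refine max_le_max ?_ le_rfl
          linarith [htri 0 (i + 1) (i + 2), hs (i + 1),
            le_max_left (t 0 (i + 1)) (a (i + 1))]
        have hL : Abar (i + 1) (i + 2) ≤ min (b (i + 2)) (T - s (i + 2) - t (i + 2) 0) := by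
          rw [hA1 (i + 1) hzn]
          exact hsingleton (i + 2) (by omega) hzn
        have hB0 : B (i + 1) (i + 2) = 0 := hB1 (i + 1) hzn
        rw [hB0, hBrec i (i + 2) le_rfl hzn]
        refine ⟨hA, le_max_left _ _, ?_⟩
        rcases max_cases 0 (Abar i (i + 2) - min (b (i + 2)) (T - s (i + 2) - t (i + 2) 0))
          with h | h <;> linarith
      | succ z hz ih =>
        intro hzn
        obtain ⟨-, -, hD⟩ := ih (by omega)
        have hA : Abar (i + 1) (z + 1) ≤ Abar i (z + 1) := by
          rw [hArec (i + 1) (z + 1) (by omega) hzn, hArec i (z + 1) (by omega) hzn,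
            Nat.add_sub_cancel]
          exact max_le_max (by linarith) le_rfl
        rw [hBrec (i + 1) (z + 1) (by omega) hzn, hBrec i (z + 1) (by omega) hzn]
        refine ⟨hA, max_le_max le_rfl (by linarith), ?_⟩
        generalize min (b (z + 1)) (T - s (z + 1) - t (z + 1) 0) = L
        rcases max_cases 0 (Abar (i + 1) (z + 1) - L) with h | h <;>
          rcases max_cases 0 (Abar i (z + 1) - L) with h' | h' <;> linarith
    have hsum : ∑ z ∈ Finset.Icc (i + 1 + 1) y, B (i + 1) z ≤
        ∑ z ∈ Finset.Icc (i + 1) y, B i z := by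
      rw [← Finset.add_sum_Ioc_eq_sum_Icc (by omega : i + 1 ≤ y), hB1 i (by omega), zero_add,
        ← Finset.Icc_add_one_left_eq_Ioc]
      refine Finset.sum_le_sum fun z hz => ?_
      rw [Finset.mem_Icc] at hz
      exact (hmono z hz.1 (by omega)).2.1
    exact mul_le_mul_of_nonneg_left hsum hβ
end

section
/- Assume the travel times satisfy the triangle inequality t_{u,v} + t_{v,w} ≥ t_{u,w} for all nodes u, v, w, and assume singleton-feasibility. Let 0 ≤ i < j < x ≤ n and suppose firstWarp(i) and firstWarp(j) both exist with firstWarp(i) ≤ x and firstWarp(j) ≤ x. Then for every y with x ≤ y ≤ n: pen_{βa}(i,y) − pen_{βa}(j,y) = pen_{βa}(i,x) − pen_{βa}(j,x); that is, once both routes have warped, their time-warp penalty difference is constant under further extension. -/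
theorem stmt_18 (n : ℕ) (hn : 1 ≤ n)
    (t : ℕ → ℕ → ℝ) (ht : ∀ u v, 0 ≤ t u v)
    (htri : ∀ u v w, t u w ≤ t u v + t v w)
    (s a b : ℕ → ℝ) (hs : ∀ z, 0 ≤ s z) (T : ℝ) (β : ℝ) (hβ : 0 ≤ β)
    (Abar B : ℕ → ℕ → ℝ)
    (hA1 : ∀ i, i + 1 ≤ n → Abar i (i + 1) = max (t 0 (i + 1)) (a (i + 1)))
    (hB1 : ∀ i, i + 1 ≤ n → B i (i + 1) = 0)
    (hArec : ∀ i z, i + 2 ≤ z → z ≤ n →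
      Abar i z = max (Abar i (z - 1) - B i (z - 1) + s (z - 1) + t (z - 1) z) (a z))
    (hBrec : ∀ i z, i + 2 ≤ z → z ≤ n →
      B i z = max 0 (Abar i z - min (b z) (T - s z - t z 0)))
    (hsingleton : ∀ z, 1 ≤ z → z ≤ n →
      max (t 0 z) (a z) ≤ min (b z) (T - s z - t z 0))
    :
    ∀ i j x fwi fwj : ℕ, i < j → j < x → x ≤ n →
      IsFirstWarp n B i fwi → IsFirstWarp n B j fwj →
      fwi ≤ x → fwj ≤ x →
        ∀ y : ℕ, x ≤ y → y ≤ n →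
          penBA β B i y - penBA β B j y = penBA β B i x - penBA β B j x := by
  intro i j x fwi fwj hij hjx hxn _ hwj _ hfx y hxy hyn
  obtain ⟨hjf, hfn, hpos, -⟩ := hwj
  -- The corrected start time `Abar - B` is `Abar` capped at the latest feasible start.
  have hcap : ∀ k z, k < z → z ≤ n →
      Abar k z - B k z = min (Abar k z) (min (b z) (T - s z - t z 0)) := by
    intro k z hkz hzn
    rcases Nat.eq_or_lt_of_le (Nat.succ_le_of_lt hkz) with h | h
    · obtain rfl : k + 1 = z := h
      rw [hB1 k hzn, sub_zero, hA1 k hzn]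
      exact (min_eq_left (hsingleton (k + 1) (by omega) hzn)).symm
    · rw [hBrec k z h hzn]
      rcases le_total (Abar k z) (min (b z) (T - s z - t z 0)) with h' | h'
      · rw [min_eq_left h', max_eq_left (by linarith)]; ring
      · rw [min_eq_right h', max_eq_right (by linarith)]; ring
  have hstep : ∀ k z, k < z → z + 1 ≤ n →
      Abar k (z + 1) = max (Abar k z - B k z + s z + t z (z + 1)) (a (z + 1)) := by
    intro k z hkz hzn
    simpa using hArec k (z + 1) (by omega) hzn
  have hlower : ∀ z, i < z → z ≤ n → t 0 z ≤ Abar i z - B i z := by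
    intro z hiz
    induction z, hiz using Nat.le_induction with
    | base =>
      intro hzn
      rw [hB1 i hzn, sub_zero, hA1 i hzn]
      exact le_max_left _ _
    | succ z hiz ih =>
      intro hzn
      rw [hcap i (z + 1) (by omega) hzn]
      refine le_min ?_ ((le_max_left _ _).trans (hsingleton (z + 1) (by omega) hzn))
      rw [hstep i z hiz hzn]
      refine le_trans ?_ (le_max_left _ _)
      linarith [ih (by omega), htri 0 z (z + 1), hs z]
  have hmono : ∀ z, j < z → z ≤ n → Abar j z - B j z ≤ Abar i z - B i z := by
    intro z hjz
    induction z, hjz using Nat.le_induction with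
    | base =>
      intro hzn
      rw [hcap i (j + 1) (by omega) hzn, hcap j (j + 1) (by omega) hzn]
      refine min_le_min_right _ ?_
      rw [hA1 j hzn, hstep i j hij hzn]
      refine max_le_max_right _ ?_
      linarith [hlower j hij (by omega), htri 0 j (j + 1), hs j]
    | succ z hjz ih =>
      intro hzn
      rw [hcap i (z + 1) (by omega) hzn, hcap j (z + 1) (by omega) hzn]
      refine min_le_min_right _ ?_
      rw [hstep j z hjz hzn, hstep i z (by omega) hzn]
      refine max_le_max_right _ ?_
      linarith [ih (by omega)]
  -- From the first warp of the shorter route on, both routes run at the same time.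
  have heq : ∀ z, fwj ≤ z → z ≤ n → Abar i z - B i z = Abar j z - B j z := by
    intro z hfz
    induction z, hfz using Nat.le_induction with
    | base =>
      intro hzn
      refine le_antisymm ?_ (hmono fwj hjf hzn)
      have hj := hcap j fwj hjf hzn
      rw [hcap i fwj (by omega) hzn]
      rcases min_choice (Abar j fwj) (min (b fwj) (T - s fwj - t fwj 0)) with h | h
      · linarith
      · rw [hj, h]
        exact min_le_right _ _
    | succ z hfz ih =>
      intro hzn
      rw [hcap i (z + 1) (by omega) hzn, hcap j (z + 1) (by omega) hzn,
        hstep i z (by omega) hzn, hstep j z (by omega) hzn, ih (by omega)]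
  induction y, hxy using Nat.le_induction with
  | base => rfl
  | succ z hxz ih =>
    have hB : B i (z + 1) = B j (z + 1) := by
      have h := heq (z + 1) (by omega) hyn
      rw [hstep i z (by omega) hyn, hstep j z (by omega) hyn, heq z (by omega) (by omega)] at h
      linarith
    rw [← ih (by omega)]
    simp only [penBA]
    rw [Finset.sum_Icc_succ_top (by omega), Finset.sum_Icc_succ_top (by omega), hB]
    ring
end

section
/- Assume the travel times satisfy the triangle inequality t_{u,v} + t_{v,w} ≥ t_{u,w} for all nodes u, v, w, and assume singleton-feasibility. Let 0 ≤ i < n and suppose x := firstWarp(i) exists. Then for every z with x < z ≤ n: Ā(i,z) = Ā(0,z) and B(i,z) = B(0,z); that is, beyond its first warp, the route starting after tour position i has exactly the same time-warped service start times and warp amounts as the route starting at depot position 0. -/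
theorem stmt_19 (n : ℕ) (hn : 1 ≤ n)
    (t : ℕ → ℕ → ℝ) (ht : ∀ u v, 0 ≤ t u v)
    (htri : ∀ u v w, t u w ≤ t u v + t v w)
    (s a b : ℕ → ℝ) (hs : ∀ z, 0 ≤ s z) (T : ℝ) (β : ℝ) (hβ : 0 ≤ β)
    (Abar B : ℕ → ℕ → ℝ)
    (hA1 : ∀ i, i + 1 ≤ n → Abar i (i + 1) = max (t 0 (i + 1)) (a (i + 1)))
    (hB1 : ∀ i, i + 1 ≤ n → B i (i + 1) = 0)
    (hArec : ∀ i z, i + 2 ≤ z → z ≤ n →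
      Abar i z = max (Abar i (z - 1) - B i (z - 1) + s (z - 1) + t (z - 1) z) (a z))
    (hBrec : ∀ i z, i + 2 ≤ z → z ≤ n →
      B i z = max 0 (Abar i z - min (b z) (T - s z - t z 0)))
    (hsingleton : ∀ z, 1 ≤ z → z ≤ n →
      max (t 0 z) (a z) ≤ min (b z) (T - s z - t z 0))
    :
    ∀ i x : ℕ, i < n → IsFirstWarp n B i x →
      ∀ z : ℕ, x < z → z ≤ n → Abar i z = Abar 0 z ∧ B i z = B 0 z := by
  have hB : ∀ i z, i < z → z ≤ n →
      B i z = max 0 (Abar i z - min (b z) (T - s z - t z 0)) := by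
    intro i z hiz hzn
    obtain rfl | h := Nat.eq_or_lt_of_le hiz
    · rw [hB1 i hzn, hA1 i hzn, max_eq_left]
      exact sub_nonpos.2 (hsingleton _ (by omega) hzn)
    · exact hBrec i z h hzn
  -- The start time after warping is the start time capped by the latest feasible start.
  have hE : ∀ i z, i < z → z ≤ n →
      Abar i z - B i z = min (Abar i z) (min (b z) (T - s z - t z 0)) := by
    intro i z hiz hzn
    rw [hB i z hiz hzn, ← min_sub_sub_left, sub_zero, sub_sub_cancel]
  have hA : ∀ i z, i < z → z + 1 ≤ n →
      Abar i (z + 1) = max (Abar i z - B i z + s z + t z (z + 1)) (a (z + 1)) :=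
    fun i z hiz hzn => hArec i (z + 1) (by omega) hzn
  have hlow : ∀ i z, i < z → z ≤ n → max (t 0 z) (a z) ≤ Abar i z := by
    intro i z hiz
    induction z, hiz using Nat.le_induction with
    | base => exact fun h => (hA1 i h).ge
    | succ z hiz ih =>
      intro hzn
      have hz : t 0 z ≤ Abar i z - B i z := by
        rw [hE i z hiz (by omega)]
        exact (le_max_left _ _).trans
          (le_min (ih (by omega)) (hsingleton z (by omega) (by omega)))
      rw [hA i z hiz hzn]
      refine max_le_max_right _ ?_
      linarith [htri 0 z (z + 1), hs z]
  have hmono : ∀ i z, i < z → z ≤ n → Abar i z ≤ Abar 0 z := by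
    intro i z hiz
    induction z, hiz using Nat.le_induction with
    | base => exact fun h => (hA1 i h).le.trans (hlow 0 _ (by omega) h)
    | succ z hiz ih =>
      intro hzn
      have hz : Abar i z - B i z ≤ Abar 0 z - B 0 z := by
        rw [hE i z hiz (by omega), hE 0 z (by omega) (by omega)]
        exact min_le_min_right _ (ih (by omega))
      rw [hA i z hiz hzn, hA 0 z (by omega) hzn]
      exact max_le_max_right _ (by linarith)
  rintro i x - ⟨hix, hxn, hpos, -⟩ z hxz
  have hx : Abar i x - B i x = Abar 0 x - B 0 x := by
    have hcap : min (b x) (T - s x - t x 0) ≤ Abar i x := by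
      by_contra! h
      rw [hB i x hix hxn, max_eq_left (by linarith)] at hpos
      exact hpos.false
    rw [hE i x hix hxn, hE 0 x (by omega) hxn, min_eq_right hcap,
      min_eq_right (hcap.trans (hmono i x hix hxn))]
  have hstep : ∀ y, i < y → y + 1 ≤ n → Abar i y - B i y = Abar 0 y - B 0 y →
      Abar i (y + 1) = Abar 0 (y + 1) ∧ B i (y + 1) = B 0 (y + 1) := by
    intro y hiy hyn h
    have hAeq : Abar i (y + 1) = Abar 0 (y + 1) := by
      rw [hA i y hiy hyn, hA 0 y (by omega) hyn, h]
    exact ⟨hAeq, by rw [hB i _ (by omega) hyn, hB 0 _ (by omega) hyn, hAeq]⟩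
  induction z, hxz using Nat.le_induction with
  | base => exact fun hzn => hstep x hix hzn hx
  | succ z hxz ih =>
    intro hzn
    obtain ⟨hAz, hBz⟩ := ih (by omega)
    exact hstep z (by omega) hzn (by rw [hAz, hBz])
end
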